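/- Let n = 4, let ω be given by ω_{14} = 1/2, ω_{41} = 2 and ω_{ij} = 1 for all other pairs (i,j), and let ω' be given by the matrix (ω'_{ij}) with rows (1,1,2,1/2), (1,1,1,1), (1/2,1,1,1/8), (2,1,8,1). Then Ω(ω) = V(x_1) ∪ V(x_4) ∪ V(x_2, x_3) while Ω(ω') = ⋃_{1 ≤ i < j ≤ 4} V(x_i, x_j); moreover, there is no ℂ-linear automorphism of ℂ^4 mapping Ω(ω) ∪ {0} onto Ω(ω') ∪ {0}. In particular the point varieties of S^4_ω and S^4_{ω'} are not isomorphic. -/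

import Mathlib

/-- The cyclic `q`-number of a 3-cycle `(i j k)`: `q_{(ijk)}(ω) = ω_{ij} ω_{jk} ω_{ki}`. -/
def q3 (ω : Fin 4 → Fin 4 → ℂ) (i j k : Fin 4) : ℂ := ω i j * ω j k * ω k i

/-- The (affine cone, minus the origin, over the) point variety of `S^4_ω`:
`Ω(ω) = {x ≠ 0 : x_i x_j x_k = 0 for every triple i < j < k with q_{(ijk)}(ω) ≠ 1}`. -/
def Omega (ω : Fin 4 → Fin 4 → ℂ) : Set (Fin 4 → ℂ) :=
  {x | x ≠ 0 ∧ ∀ i j k : Fin 4, i < j → j < k → q3 ω i j k ≠ 1 →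
    x i * x j * x k = 0}

/-- The hyperplane `V(x_a)` (minus the origin). -/
def Vh (a : Fin 4) : Set (Fin 4 → ℂ) := {x | x ≠ 0 ∧ x a = 0}

/-- The line `V(x_a, x_b)` (minus the origin). -/
def Vl (a b : Fin 4) : Set (Fin 4 → ℂ) := {x | x ≠ 0 ∧ x a = 0 ∧ x b = 0}

/-- Two distinct coordinates of a linear automorphism of `ℂ^n` cannot both vanish on the same
coordinate hyperplane. -/
lemma coord_unique_of_vanish_on_hyperplane {n : ℕ} (f : (Fin n → ℂ) ≃ₗ[ℂ] (Fin n → ℂ))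
    {c a b : Fin n} (ha : ∀ x : Fin n → ℂ, x c = 0 → f x a = 0)
    (hb : ∀ x : Fin n → ℂ, x c = 0 → f x b = 0) : a = b := by
  by_contra hab
  have key : ∀ d, (∀ x : Fin n → ℂ, x c = 0 → f x d = 0) →
      ∀ x, f x d = x c * f (Pi.single c 1) d := by
    intro d hd x
    have h := hd (x - x c • Pi.single c 1) (by simp)
    simpa [map_sub, sub_eq_zero] using h
  have h₁ := key a ha (f.symm (Pi.single a 1))
  have h₂ := key b hb (f.symm (Pi.single a 1))
  have h₃ := key b hb (f.symm (Pi.single b 1))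
  simp only [LinearEquiv.apply_symm_apply, Pi.single_eq_same,
    Pi.single_eq_of_ne (Ne.symm hab)] at h₁ h₂ h₃
  rcases mul_eq_zero.mp h₂.symm with h | h <;> simp [h] at h₁ h₃

/-- A linear automorphism of `ℂ^n` maps some point of a given coordinate hyperplane to a point
with at most one vanishing coordinate. -/
lemma exists_mem_hyperplane_coord_ne_zero {n : ℕ} (f : (Fin n → ℂ) ≃ₗ[ℂ] (Fin n → ℂ))
    (c : Fin n) : ∃ x : Fin n → ℂ, x c = 0 ∧ ∀ a b, f x a = 0 → f x b = 0 → a = b := by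
  let g (i : Fin n) : Module.Dual ℂ (Fin n → ℂ) := LinearMap.proj i ∘ₗ f.toLinearMap
  let p : Submodule ℂ (Fin n → ℂ) := LinearMap.ker (LinearMap.proj c)
  obtain ⟨x, hxp, hx⟩ := Module.Dual.exists_forall_mem_ne_zero_of_forall_exists p
    (fun i : {i // ∃ x ∈ p, g i x ≠ 0} => g i) fun i => i.2
  have hv : ∀ a, f x a = 0 → ∀ y : Fin n → ℂ, y c = 0 → f y a = 0 := by
    intro a ha y hy
    by_contra hne
    exact hx ⟨a, y, hy, hne⟩ ha
  exact ⟨x, hxp, fun a b ha hb => coord_unique_of_vanish_on_hyperplane f (hv a ha) (hv b hb)⟩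

/-- No linear automorphism of `ℂ^4` maps a coordinate hyperplane into the union of the
codimension two coordinate subspaces. -/
lemma exists_mem_hyperplane_notMem_lines (f : (Fin 4 → ℂ) ≃ₗ[ℂ] (Fin 4 → ℂ)) (c : Fin 4) :
    ∃ x : Fin 4 → ℂ, x c = 0 ∧
      f x ∉ (Vl 0 1 ∪ Vl 0 2 ∪ Vl 0 3 ∪ Vl 1 2 ∪ Vl 1 3 ∪ Vl 2 3) ∪ {0} := by
  obtain ⟨x, hxc, hx⟩ := exists_mem_hyperplane_coord_ne_zero f c
  refine ⟨x, hxc, ?_⟩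
  rintro ((((((⟨-, h, h'⟩ | ⟨-, h, h'⟩) | ⟨-, h, h'⟩) | ⟨-, h, h'⟩) | ⟨-, h, h'⟩) |
    ⟨-, h, h'⟩) | h)
  · exact absurd (hx _ _ h h') (by decide)
  · exact absurd (hx _ _ h h') (by decide)
  · exact absurd (hx _ _ h h') (by decide)
  · exact absurd (hx _ _ h h') (by decide)
  · exact absurd (hx _ _ h h') (by decide)
  · exact absurd (hx _ _ h h') (by decide)
  · rw [Set.mem_singleton_iff] at h
    exact absurd (hx 0 1 (by simp [h]) (by simp [h])) (by decide)

/-- The condition defining `Omega` written out over the four triples `i < j < k`. -/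
lemma mem_Omega_iff (ω : Fin 4 → Fin 4 → ℂ) (x : Fin 4 → ℂ) :
    x ∈ Omega ω ↔ x ≠ 0 ∧ (q3 ω 0 1 2 ≠ 1 → x 0 * x 1 * x 2 = 0) ∧
      (q3 ω 0 1 3 ≠ 1 → x 0 * x 1 * x 3 = 0) ∧ (q3 ω 0 2 3 ≠ 1 → x 0 * x 2 * x 3 = 0) ∧
      (q3 ω 1 2 3 ≠ 1 → x 1 * x 2 * x 3 = 0) := by
  refine and_congr_right fun _ => ⟨fun h => ⟨h 0 1 2 (by decide) (by decide),
    h 0 1 3 (by decide) (by decide), h 0 2 3 (by decide) (by decide),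
    h 1 2 3 (by decide) (by decide)⟩, ?_⟩
  rintro ⟨h₁, h₂, h₃, h₄⟩ i j k hij hjk
  fin_cases i <;> fin_cases j <;> first | exact absurd hij (by decide) | skip
  all_goals fin_cases k <;> first | exact absurd hjk (by decide) | assumption

/-- For `ω` with `ω_{14} = 1/2`, `ω_{41} = 2` (all other entries `1`) and `ω'` the
matrix with rows `(1,1,2,1/2), (1,1,1,1), (1/2,1,1,1/8), (2,1,8,1)`, the point
variety of `S^4_ω` is `V(x_1) ∪ V(x_4) ∪ V(x_2,x_3)` while that of `S^4_{ω'}` is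
the union of the six coordinate lines, and no linear automorphism of `ℂ^4` maps
one onto the other: the point varieties are not isomorphic. -/
theorem point_varieties_not_isomorphic (ω ω' : Fin 4 → Fin 4 → ℂ)
    (hω : ω = fun i j => !![(1:ℂ), 1, 1, 1/2; 1, 1, 1, 1; 1, 1, 1, 1; 2, 1, 1, 1] i j)
    (hω' : ω' = fun i j =>
      !![(1:ℂ), 1, 2, 1/2; 1, 1, 1, 1; 1/2, 1, 1, 1/8; 2, 1, 8, 1] i j) :
    Omega ω = Vh 0 ∪ Vh 3 ∪ Vl 1 2 ∧
    Omega ω' = Vl 0 1 ∪ Vl 0 2 ∪ Vl 0 3 ∪ Vl 1 2 ∪ Vl 1 3 ∪ Vl 2 3 ∧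
    ¬∃ f : (Fin 4 → ℂ) ≃ₗ[ℂ] (Fin 4 → ℂ),
        f '' (Omega ω ∪ {0}) = Omega ω' ∪ {0} := by
  have hΩ : Omega ω = Vh 0 ∪ Vh 3 ∪ Vl 1 2 := by
    have h₁ : q3 ω 0 1 2 = 1 := by simp [hω, q3]
    have h₂ : q3 ω 0 1 3 ≠ 1 := by simp [hω, q3]
    have h₃ : q3 ω 0 2 3 ≠ 1 := by simp [hω, q3]
    have h₄ : q3 ω 1 2 3 = 1 := by simp [hω, q3]
    ext x
    simp only [mem_Omega_iff, h₁, h₂, h₃, h₄, Vh, Vl, Set.mem_union, Set.mem_ofPred_eq,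
      mul_eq_zero, ne_eq, not_true_eq_false, not_false_eq_true, forall_const, false_implies]
    grind
  have hΩ' : Omega ω' = Vl 0 1 ∪ Vl 0 2 ∪ Vl 0 3 ∪ Vl 1 2 ∪ Vl 1 3 ∪ Vl 2 3 := by
    have h₁ : q3 ω' 0 1 2 ≠ 1 := by simp [hω', q3]
    have h₂ : q3 ω' 0 1 3 ≠ 1 := by simp [hω', q3]
    have h₃ : q3 ω' 0 2 3 ≠ 1 := by
      simp [hω', q3]
      norm_num
    have h₄ : q3 ω' 1 2 3 ≠ 1 := by simp [hω', q3]
    ext x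
    simp only [mem_Omega_iff, h₁, h₂, h₃, h₄, Vl, Set.mem_union, Set.mem_ofPred_eq,
      mul_eq_zero, ne_eq, not_false_eq_true, forall_const]
    grind
  refine ⟨hΩ, hΩ', ?_⟩
  rintro ⟨f, hf⟩
  obtain ⟨x, hx, hfx⟩ := exists_mem_hyperplane_notMem_lines f 0
  rw [← hΩ', ← hf, hΩ] at hfx
  refine hfx ⟨x, ?_, rfl⟩
  by_cases h : x = 0
  · exact Or.inr h
  · exact Or.inl (Or.inl (Or.inl ⟨h, hx⟩))
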